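/- Every extremal concept class C ⊆ {0,1}^n of VC dimension 2 admits an unlabelled compression scheme of size 2. -/

import Mathlib

variable {n : ℕ}

/-- Coordinatewise intersection (Boolean product) of two vertices. -/
def interV {α : Type*} (v w : α → Bool) : α → Bool := fun i => v i && w i

/-- A class is intersection closed if it is closed under coordinatewise products. -/
def IntersectionClosed {α : Type*} (C : Set (α → Bool)) : Prop :=
  ∀ v ∈ C, ∀ w ∈ C, interV v w ∈ C

/-- The intersection closure: all iterated intersections of nonempty finite subsets. -/
def interClosure {α : Type*} (C : Set (α → Bool)) : Set (α → Bool) :=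
  {x | ∃ S : Finset (α → Bool), S.Nonempty ∧ ↑S ⊆ C ∧ x = fun i => S.inf fun u => u i}

/-- Coordinate projection to the coordinates in `J`. -/
def proj (J : Finset (Fin n)) (v : Fin n → Bool) : {i // i ∈ J} → Bool := fun j => v j.1

/-- `C` shatters `I` if the projection of `C` to `I` is the full cube. -/
def Shatters (C : Set (Fin n → Bool)) (I : Finset (Fin n)) : Prop :=
  proj I '' C = Set.univ

/-- The VC dimension: the largest cardinality of a shattered set of coordinates. -/
noncomputable def VCdim (C : Set (Fin n → Bool)) : ℕ :=
  sSup {k | ∃ I : Finset (Fin n), I.card = k ∧ Shatters C I}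

/-- A shortest path in `A` from `u` to `v`: a sequence of length `hammingDist u v`
starting at `u`, ending at `v`, with all vertices in `A` and consecutive vertices
at Hamming distance `1`. -/
def IsShortestPath (A : Set (Fin n → Bool)) (u v : Fin n → Bool)
    (seq : Fin (hammingDist u v + 1) → Fin n → Bool) : Prop :=
  seq 0 = u ∧ seq (Fin.last (hammingDist u v)) = v ∧ (∀ i, seq i ∈ A) ∧
    ∀ i : Fin (hammingDist u v), hammingDist (seq i.castSucc) (seq i.succ) = 1

/-- A class is shortest-path closed if any two of its vertices are joined by a
shortest path inside the class. -/
def SPClosed (C : Set (Fin n → Bool)) : Prop :=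
  ∀ u ∈ C, ∀ v ∈ C, ∃ seq, IsShortestPath C u v seq

/-- A cube with colour set `I` (and some anchor `a` outside `I`). -/
def IsCubeOn (I : Finset (Fin n)) (c : Set (Fin n → Bool)) : Prop :=
  ∃ a : Fin n → Bool, c = {v | ∀ i, i ∉ I → v i = a i}

/-- A cube (with some colour set). -/
def IsCube (c : Set (Fin n → Bool)) : Prop := ∃ I, IsCubeOn I c

/-- `c` is a maximal cube of `A`: a cube contained in `A` not properly contained in
another cube contained in `A`. -/
def MaximalCubeIn (A c : Set (Fin n → Bool)) : Prop :=
  IsCube c ∧ c ⊆ A ∧ ∀ c', IsCube c' → c' ⊆ A → c ⊆ c' → c' = c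

/-- A class is extremal if every shattered colour set is witnessed by a cube inside
the class. -/
def Extremal (C : Set (Fin n → Bool)) : Prop :=
  ∀ I : Finset (Fin n), Shatters C I → ∃ c, IsCubeOn I c ∧ c ⊆ C

/-- The cubical colour condition for the pair `(C, D)`: every cube contained in `C`
that is not maximal in `C` has a cube in `D` with the same colour set. -/
def CCC (C D : Set (Fin n → Bool)) : Prop :=
  ∀ I c, IsCubeOn I c → c ⊆ C → ¬ MaximalCubeIn C c →
    ∃ c', IsCubeOn I c' ∧ c' ⊆ D

/-- `A` has an edge of colour `i`: two vertices of `A` differing exactly at `i`. -/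
def HasEdge (A : Set (Fin n → Bool)) (i : Fin n) : Prop :=
  ∃ v ∈ A, ∃ w ∈ A, v i ≠ w i ∧ ∀ j, j ≠ i → v j = w j

/-- An unlabelled compression scheme of size `k` for `C`. -/
def HasCompression (C : Set (Fin n → Bool)) (k : ℕ) : Prop :=
  ∃ r : (Fin n → Bool) → Finset (Fin n),
    Set.InjOn r C ∧ (∀ v ∈ C, (r v).card ≤ k) ∧
      ∀ v ∈ C, ∀ w ∈ C, v ≠ w → ∃ i ∈ r v ∪ r w, v i ≠ w i

/-- Coordinates where `v` is `1` but `w` is `0`. -/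
def delta (v w : Fin n → Bool) : Finset (Fin n) :=
  Finset.univ.filter fun i => v i = true ∧ w i = false

/-- The vertex obtained from `v` by setting to `0` the `j` smallest (in the order
induced by the permutation `π`) coordinates of `delta v w`. -/
def stepVert (π : Equiv.Perm (Fin n)) (v w : Fin n → Bool) (j : ℕ) : Fin n → Bool :=
  fun i =>
    if i ∈ delta v w ∧ ((delta v w).filter fun i' => π i' < π i).card < j then false
    else v i

/-- The shortest-path closure construction of `C` (with respect to the linear order
on coordinates induced by `π`). -/
def spClosure (π : Equiv.Perm (Fin n)) (C : Set (Fin n → Bool)) : Set (Fin n → Bool) :=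
  {x | ∃ v ∈ C, ∃ w ∈ C, w ≤ v ∧ ∃ j ≤ (delta v w).card, x = stepVert π v w j}

/-- Coordinatewise XOR with `b` (a change of origin). -/
def xorShift (b : Fin n → Bool) (C : Set (Fin n → Bool)) : Set (Fin n → Bool) :=
  (fun v i => xor (v i) (b i)) '' C

/-- The `k`-close cube condition. -/
def KCloseCube (C : Set (Fin n → Bool)) (k : ℕ) : Prop :=
  ∃ v : Fin n → Bool, ∀ J : Finset (Fin n), J.card = k + 1 →
    ∃ b : {i // i ∈ J} → Bool, hammingDist b (proj J v) ≤ 1 ∧ b ∉ proj J '' C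

theorem Bool.eq_of_ne_of_ne {p q r : Bool} (hq : p ≠ q) (hr : p ≠ r) : q = r := by
  revert hq hr
  cases p <;> cases q <;> cases r <;> simp

theorem shatters_iff {C : Set (Fin n → Bool)} {I : Finset (Fin n)} :
    Shatters C I ↔ ∀ b : Fin n → Bool, ∃ v ∈ C, ∀ i ∈ I, v i = b i := by
  constructor
  · intro h b
    have hb : proj I b ∈ proj I '' C := h ▸ Set.mem_univ _
    obtain ⟨v, hv, hvb⟩ := hb
    exact ⟨v, hv, fun i hi => congrFun hvb ⟨i, hi⟩⟩
  · intro h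
    refine Set.eq_univ_of_forall fun b => ?_
    obtain ⟨v, hv, hvb⟩ := h fun i => if hi : i ∈ I then b ⟨i, hi⟩ else false
    refine ⟨v, hv, funext fun i => ?_⟩
    simpa [proj, i.2] using hvb i.1 i.2

theorem Shatters.mono {C D : Set (Fin n → Bool)} {I : Finset (Fin n)} (h : Shatters D I)
    (hDC : D ⊆ C) : Shatters C I := by
  rw [shatters_iff] at h ⊢
  intro b
  obtain ⟨v, hv, hvb⟩ := h b
  exact ⟨v, hDC hv, hvb⟩

theorem Shatters.card_le_VCdim {C : Set (Fin n → Bool)} {I : Finset (Fin n)}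
    (h : Shatters C I) : I.card ≤ VCdim C := by
  refine le_csSup ⟨n, ?_⟩ ⟨I, rfl, h⟩
  rintro k ⟨J, rfl, -⟩
  simpa using J.card_le_univ

/-- `C` contains the cube with colour set `I` through the vertex `a`. -/
def CubeAt (C : Set (Fin n → Bool)) (I : Finset (Fin n)) (a : Fin n → Bool) : Prop :=
  ∀ v : Fin n → Bool, (∀ i, i ∉ I → v i = a i) → v ∈ C

theorem extremal_iff {C : Set (Fin n → Bool)} :
    Extremal C ↔ ∀ I, Shatters C I → ∃ a, CubeAt C I a := by
  refine forall_congr' fun I => imp_congr_right fun _ => ?_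
  constructor
  · rintro ⟨_, ⟨a, rfl⟩, h⟩
    exact ⟨a, h⟩
  · rintro ⟨a, h⟩
    exact ⟨_, ⟨a, rfl⟩, h⟩

theorem CubeAt.shatters {C : Set (Fin n → Bool)} {I : Finset (Fin n)} {a : Fin n → Bool}
    (h : CubeAt C I a) : Shatters C I := by
  rw [shatters_iff]
  exact fun b => ⟨fun i => if i ∈ I then b i else a i, h _ (by simp +contextual),
    by simp +contextual⟩

/-- If two parallel `I`-cubes differ at `k`, then `insert k I` is shattered. -/
theorem CubeAt.shatters_insert {C : Set (Fin n → Bool)} {I : Finset (Fin n)}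
    {a b : Fin n → Bool} (ha : CubeAt C I a) (hb : CubeAt C I b) {k : Fin n}
    (hab : a k ≠ b k) : Shatters C (insert k I) := by
  rw [shatters_iff]
  intro p
  by_cases hp : p k = a k
  · refine ⟨fun i => if i ∈ I then p i else a i, ha _ (by simp +contextual), ?_⟩
    intro i hi
    by_cases i ∈ I <;> grind
  · refine ⟨fun i => if i ∈ I then p i else b i, hb _ (by simp +contextual), ?_⟩
    have hbp : b k = p k := Bool.eq_of_ne_of_ne hab (Ne.symm hp)
    intro i hi
    by_cases i ∈ I <;> grind

theorem Extremal.inter_halfspace {C : Set (Fin n → Bool)} (hC : Extremal C) (k : Fin n)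
    (b : Bool) : Extremal (C ∩ {x | x k = b}) := by
  rw [extremal_iff] at hC ⊢
  intro I hI
  have hI' := shatters_iff.1 hI
  have hk : k ∉ I := by
    intro hk
    obtain ⟨v, hv, hvb⟩ := hI' fun _ => !b
    have h1 : v k = b := hv.2
    simp [hvb k hk] at h1
  by_cases h : Shatters C (insert k I)
  · obtain ⟨a, ha⟩ := hC _ h
    refine ⟨Function.update a k b, fun v hv => ⟨ha v fun i hi => ?_, ?_⟩⟩
    · rw [Finset.mem_insert, not_or] at hi
      simpa [hi.1] using hv i hi.2
    · simpa using hv k hk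
  · obtain ⟨a, ha⟩ := hC _ (hI.mono Set.inter_subset_left)
    have hak : a k = b := by
      by_contra hak
      refine h (shatters_iff.2 fun p => ?_)
      by_cases hp : p k = b
      · obtain ⟨v, hv, hvp⟩ := hI' p
        have h1 : v k = b := hv.2
        exact ⟨v, hv.1, by simpa [h1, hp] using hvp⟩
      · refine ⟨fun i => if i ∈ I then p i else a i, ha _ (by simp +contextual), ?_⟩
        have hap : a k = p k := Bool.eq_of_ne_of_ne (Ne.symm hak) (Ne.symm hp)
        intro i hi
        by_cases i ∈ I <;> grind
    exact ⟨a, fun v hv => ⟨ha v hv, (hv k hk).trans hak⟩⟩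

theorem Extremal.inter_subcube {C : Set (Fin n → Bool)} (hC : Extremal C)
    (K : Finset (Fin n)) (a : Fin n → Bool) : Extremal (C ∩ {x | ∀ k ∈ K, x k = a k}) := by
  induction K using Finset.induction_on with
  | empty => simpa using hC
  | insert k K _ ih =>
    convert ih.inter_halfspace k (a k) using 1
    ext x
    simp only [Set.mem_inter_iff, Set.mem_ofPred_eq, Finset.forall_mem_insert]
    tauto

/-- The `I`-cubes of an extremal class form an isometric family: from any of them one can move
one step towards any other. -/
theorem Extremal.exists_adjacent_cube {C : Set (Fin n → Bool)} (hC : Extremal C)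
    {I : Finset (Fin n)} {a b : Fin n → Bool} (ha : CubeAt C I a) (hb : CubeAt C I b)
    (hab : ∃ j, j ∉ I ∧ a j ≠ b j) :
    ∃ j, j ∉ I ∧ a j ≠ b j ∧ CubeAt C I (Function.update a j (b j)) := by
  induction hN : (Finset.univ.filter fun j => j ∉ I ∧ a j ≠ b j).card using
    Nat.strong_induction_on generalizing b with
  | _ N ih =>
  obtain ⟨j, hjI, hj⟩ := hab
  set K := Finset.univ.filter fun k => k ∉ I ∧ a k = b k with hK
  have hE := extremal_iff.1 (hC.inter_subcube K a)
  have ha' : CubeAt (C ∩ {x | ∀ k ∈ K, x k = a k}) I a :=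
    fun v hv => ⟨ha v hv, fun k hk => hv k (by simp [hK] at hk; exact hk.1)⟩
  have hb' : CubeAt (C ∩ {x | ∀ k ∈ K, x k = a k}) I b := fun v hv => ⟨hb v hv, fun k hk => by
    simp only [hK, Finset.mem_filter, Finset.mem_univ, true_and] at hk
    rw [hv k hk.1, hk.2]⟩
  obtain ⟨c, hc⟩ := hE _ (ha'.shatters_insert hb' hj)
  have hcK : ∀ k, k ∉ I → a k = b k → c k = a k := fun k hk hkab =>
    (hc c fun _ _ => rfl).2 k (by simp [hK, hk, hkab])
  by_cases h : ∃ k, k ∉ I ∧ a k ≠ Function.update c j (a j) k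
  · obtain ⟨k, hkI, hk, hcube⟩ := ih _ (by
      rw [← hN]
      refine Finset.card_lt_card (Finset.ssubset_iff_of_subset ?_ |>.2 ⟨j, ?_, ?_⟩)
      · intro k
        simp only [Finset.mem_filter, Finset.mem_univ, true_and]
        grind [Function.update_apply]
      · simpa using ⟨hjI, hj⟩
      · simp) (fun v hv => (hc v fun i hi => by
        have := hv i
        grind [Function.update_apply]).1) h rfl
    have hkb : a k ≠ b k := by
      intro hkb
      have := hcK k hkI hkb
      grind [Function.update_apply]
    refine ⟨k, hkI, hkb, ?_⟩
    rwa [show b k = Function.update c j (a j) k by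
      revert hk hkb
      cases a k <;> cases b k <;> cases Function.update c j (a j) k <;> simp]
  · push Not at h
    refine ⟨j, hjI, hj, fun v hv => (hc v fun i hi => ?_).1⟩
    have h1 := hv i
    have h2 := h i
    grind [Function.update_apply]

/-- Two cubes of maximal dimension with the same colour set coincide. -/
theorem Extremal.cubeAt_of_shatters {C D : Set (Fin n → Bool)} (hD : Extremal D) (hDC : D ⊆ C)
    {S : Finset (Fin n)} (hVC : ∀ I, Shatters C I → I.card ≤ S.card) (hS : Shatters D S)
    {a : Fin n → Bool} (ha : CubeAt C S a) : CubeAt D S a := by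
  obtain ⟨c, hc⟩ := extremal_iff.1 hD S hS
  intro v hv
  refine hc v fun k hk => ?_
  rw [hv k hk]
  by_contra hne
  have := hVC _ (ha.shatters_insert (fun v hv => hDC (hc v hv)) hne)
  rw [Finset.card_insert_of_notMem hk] at this
  omega

theorem exists_ne_of_shatters_insert {D : Set (Fin n → Bool)} {v : Fin n → Bool}
    {S : Finset (Fin n)} (hS : Shatters (insert v D) S) (hS' : ¬ Shatters D S)
    {u : Fin n → Bool} (hu : u ∈ D) : ∃ i ∈ S, u i ≠ v i := by
  by_contra! h
  refine hS' (shatters_iff.2 fun b => ?_)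
  obtain ⟨w, rfl | hw, hwb⟩ := shatters_iff.1 hS b
  · exact ⟨u, hu, fun i hi => (h i hi).trans (hwb i hi)⟩
  · exact ⟨w, hw, hwb⟩

/-- The neighbour of `x` along the colour `i`. -/
def flipAt (x : Fin n → Bool) (i : Fin n) : Fin n → Bool := Function.update x i (!x i)

@[simp] theorem flipAt_same (x : Fin n → Bool) (i : Fin n) : flipAt x i i = !x i := by
  simp [flipAt]

theorem flipAt_of_ne (x : Fin n → Bool) {i j : Fin n} (h : j ≠ i) : flipAt x i j = x j := by
  simp [flipAt, h]

theorem flipAt_apply (x : Fin n → Bool) (i k : Fin n) :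
    flipAt x i k = if k = i then !x k else x k := by
  by_cases h : k = i
  · subst h
    simp
  · simp [h, flipAt_of_ne]

@[simp] theorem flipAt_flipAt (x : Fin n → Bool) (i : Fin n) : flipAt (flipAt x i) i = x := by
  simp [flipAt]

theorem flipAt_comm (x : Fin n → Bool) (i j : Fin n) :
    flipAt (flipAt x i) j = flipAt (flipAt x j) i := by
  ext k
  grind [flipAt_apply]

theorem eq_or_eq_flipAt {v x : Fin n → Bool} {i : Fin n} (h : ∀ k, k ≠ i → v k = x k) :
    v = x ∨ v = flipAt x i := by
  by_cases hi : v i = x i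
  · left
    ext k
    grind
  · right
    ext k
    by_cases hk : k = i
    · rw [hk, flipAt_same, Bool.eq_not]
      exact hi
    · rw [flipAt_of_ne x hk, h k hk]

theorem cubeAt_singleton_iff {C : Set (Fin n → Bool)} {i : Fin n} {a : Fin n → Bool} :
    CubeAt C {i} a ↔ a ∈ C ∧ flipAt a i ∈ C := by
  constructor
  · intro h
    exact ⟨h a fun _ _ => rfl, h _ fun k hk => flipAt_of_ne a (by simpa using hk)⟩
  · rintro ⟨h1, h2⟩ v hv
    rcases eq_or_eq_flipAt (v := v) (x := a) (i := i) (by simpa using hv) with rfl | rfl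
    exacts [h1, h2]

theorem cubeAt_pair_iff {C : Set (Fin n → Bool)} {i j : Fin n} {a : Fin n → Bool} :
    CubeAt C {i, j} a ↔ CubeAt C {i} a ∧ CubeAt C {i} (flipAt a j) := by
  constructor
  · intro h
    refine ⟨fun v hv => h v fun k hk => hv k ?_, fun v hv => h v fun k hk => ?_⟩
    · simp_all
    · simp only [Finset.mem_insert, Finset.mem_singleton, not_or] at hk
      rw [hv k (by simpa using hk.1), flipAt_of_ne a hk.2]
  · rintro ⟨h1, h2⟩ v hv
    by_cases hj : v j = a j
    · refine h1 v fun k hk => ?_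
      by_cases hkj : k = j
      · rw [hkj, hj]
      · exact hv k (by simp_all)
    · refine h2 v fun k hk => ?_
      by_cases hkj : k = j
      · subst hkj
        rwa [flipAt_same, Bool.eq_not]
      · rw [flipAt_of_ne a hkj]
        exact hv k (by simp_all)

theorem flipAt_eq_update {x z : Fin n → Bool} {j : Fin n} (h : x j ≠ z j) :
    Function.update x j (z j) = flipAt x j := by
  rw [flipAt]
  congr 1
  revert h
  cases x j <;> cases z j <;> simp

theorem hammingDist_flipAt_lt {x z : Fin n → Bool} {j : Fin n} (h : x j ≠ z j) :
    hammingDist (flipAt x j) z < hammingDist x z := by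
  refine Finset.card_lt_card (Finset.ssubset_iff_of_subset ?_ |>.2 ⟨j, ?_, ?_⟩)
  · intro k
    simp only [Finset.mem_filter, Finset.mem_univ, true_and]
    grind [flipAt_apply]
  · simpa using h
  · simpa using h

theorem Extremal.exists_boundary_edge {C D : Set (Fin n → Bool)} (hC : Extremal C)
    (hDC : D ⊂ C) (hne : D.Nonempty) : ∃ x ∈ D, ∃ i, flipAt x i ∈ C ∧ flipAt x i ∉ D := by
  obtain ⟨w, hwC, hwD⟩ := Set.exists_of_ssubset hDC
  obtain ⟨u, hu, hmin⟩ := D.toFinite.exists_minimalFor (fun u => hammingDist u w) D hne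
  have cube : ∀ a ∈ C, CubeAt C ∅ a := fun a ha v hv =>
    (funext fun i => hv i (by simp) : v = a) ▸ ha
  have huw : u ≠ w := fun h => hwD (h ▸ hu)
  obtain ⟨k, hk⟩ := Function.ne_iff.1 huw
  obtain ⟨j, -, hj, hcube⟩ :=
    hC.exists_adjacent_cube (cube u (hDC.1 hu)) (cube w hwC) ⟨k, by simp, hk⟩
  rw [flipAt_eq_update hj] at hcube
  refine ⟨u, hu, j, hcube _ fun _ _ => rfl, fun h => ?_⟩
  have h1 := hammingDist_flipAt_lt hj
  exact absurd (hmin h h1.le) (not_le.2 h1)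

/-- Starting from a boundary edge of `D` in `C`, either slide it along a square of `C` towards a
parallel edge of `D`, or rotate it around its vertex in `D`; this process terminates at a square
of `C` with exactly three vertices in `D`. -/
theorem Extremal.exists_square_of_boundary_edge {C D : Set (Fin n → Bool)} (hC : Extremal C)
    (hD : Extremal D) (hDC : D ⊆ C) (hVC : ∀ I, Shatters C I → I.card ≤ 2)
    (hcol : ∀ x ∈ D, ∀ i, flipAt x i ∈ C → flipAt x i ∉ D → Shatters D {i})
    {x z : Fin n → Bool} {i : Fin n} (hx : x ∈ D) (hvC : flipAt x i ∈ C) (hvD : flipAt x i ∉ D)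
    (hz : CubeAt D {i} z) (hzx : z i = x i) :
    ∃ w i j, i ≠ j ∧ w ∈ C ∧ w ∉ D ∧ flipAt w i ∈ D ∧ flipAt w j ∈ D ∧
      flipAt (flipAt w i) j ∈ D := by
  have hzD := (cubeAt_singleton_iff.1 hz).1
  have hzD' := (cubeAt_singleton_iff.1 hz).2
  have hxz : ∃ k, k ∉ ({i} : Finset (Fin n)) ∧ x k ≠ z k := by
    by_contra! h
    have : x = z := by
      ext k
      by_cases hk : k = i
      · rw [hk, hzx]
      · rw [h k (by simpa using hk)]
    exact hvD (this ▸ hzD')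
  obtain ⟨j, hji, hj, hcube⟩ := hC.exists_adjacent_cube
    (cubeAt_singleton_iff.2 ⟨hDC hx, hvC⟩) (fun v hv => hDC (hz v hv)) hxz
  rw [Finset.mem_singleton] at hji
  rw [flipAt_eq_update hj] at hcube
  have hcube' := cubeAt_singleton_iff.1 hcube
  by_cases hx1 : flipAt x j ∈ D
  · by_cases hv1 : flipAt (flipAt x j) i ∈ D
    · refine ⟨flipAt x i, i, j, Ne.symm hji, hvC, hvD, ?_, ?_, ?_⟩
      · simpa using hx
      · rwa [flipAt_comm]
      · simpa using hx1
    · have hlt := hammingDist_flipAt_lt hj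
      have hi : flipAt x j i = x i := flipAt_of_ne x (Ne.symm hji)
      exact hC.exists_square_of_boundary_edge hD hDC hVC hcol hx1 hcube'.2 hv1 hz
        (hzx.trans hi.symm)
  · have hnot : ¬ Shatters D {i, j} := fun h => by
      have hcard : ({i, j} : Finset (Fin n)).card = 2 := Finset.card_pair (Ne.symm hji)
      have := hD.cubeAt_of_shatters hDC (by simpa [hcard] using hVC) h
        (cubeAt_pair_iff.2 ⟨cubeAt_singleton_iff.2 ⟨hDC hx, hvC⟩, hcube⟩)
      exact hvD (cubeAt_singleton_iff.1 (cubeAt_pair_iff.1 this).1).2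
    have hsub : ∀ y ∈ D, y j = x j → y i = x i := by
      intro y hy hyj
      by_contra hyi
      refine hnot (shatters_iff.2 fun b => ?_)
      simp only [Finset.mem_insert, Finset.mem_singleton, forall_eq_or_imp, forall_eq]
      by_cases hbi : b i = x i <;> by_cases hbj : b j = x j
      · exact ⟨x, hx, hbi.symm, hbj.symm⟩
      · exact ⟨z, hzD, hzx.trans hbi.symm, Bool.eq_of_ne_of_ne hj (Ne.symm hbj)⟩
      · exact ⟨y, hy, Bool.eq_of_ne_of_ne (Ne.symm hyi) (Ne.symm hbi), hyj.trans hbj.symm⟩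
      · refine ⟨flipAt z i, hzD', ?_, ?_⟩
        · rw [flipAt_same, hzx, eq_comm, Bool.eq_not]
          exact hbi
        · rw [flipAt_of_ne z hji]
          exact Bool.eq_of_ne_of_ne hj (Ne.symm hbj)
    have hlt : {y ∈ D | y j = x j}.ncard < {y ∈ D | y i = x i}.ncard := by
      refine Set.ncard_lt_ncard ⟨fun y hy => ⟨hy.1, hsub y hy.1 hy.2⟩, fun h => ?_⟩
      exact hj (h (⟨hzD, hzx⟩ : z ∈ {y ∈ D | y i = x i})).2.symm
    obtain ⟨z', hz'⟩ := extremal_iff.1 hD _ (hcol x hx j hcube'.1 hx1)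
    have hz'' : CubeAt D {j} (Function.update z' j (x j)) := fun v hv => hz' v fun k hk => by
      rw [hv k hk, Function.update_of_ne (by simpa using hk)]
    exact hC.exists_square_of_boundary_edge hD hDC hVC hcol hx hcube'.1 hx1 hz'' (by simp)
termination_by ({y ∈ D | y i = x i}.ncard, hammingDist x z)
decreasing_by
  · simp only [hi]
    exact Prod.Lex.right _ hlt
  · exact Prod.Lex.left _ _ hlt

/-- An extremal class can be extended by one vertex at a time inside a larger extremal class of
VC dimension at most `2`. -/
theorem Extremal.exists_extremal_insert {C D : Set (Fin n → Bool)} (hC : Extremal C)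
    (hD : Extremal D) (hDC : D ⊂ C) (hne : D.Nonempty) (hVC : ∀ I, Shatters C I → I.card ≤ 2) :
    ∃ v ∈ C, v ∉ D ∧ Extremal (insert v D) ∧
      ∃ S, Shatters (insert v D) S ∧ ¬ Shatters D S := by
  -- A newly shattered set is the colour set of a cube through `v`.
  have key : ∀ (v : Fin n → Bool) (S : Finset (Fin n)), CubeAt (insert v D) S v →
      (∀ T, Shatters (insert v D) T → ¬ Shatters D T → T = S) → Extremal (insert v D) := by
    intro v S hS hT
    refine extremal_iff.2 fun T h => ?_
    by_cases hDT : Shatters D T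
    · obtain ⟨a, ha⟩ := extremal_iff.1 hD T hDT
      exact ⟨a, fun u hu => Or.inr (ha u hu)⟩
    · exact ⟨v, hT T h hDT ▸ hS⟩
  have mem_of_flip : ∀ (v : Fin n → Bool) (i : Fin n) (T : Finset (Fin n)), flipAt v i ∈ D →
      Shatters (insert v D) T → ¬ Shatters D T → i ∈ T := by
    intro v i T hv hT hDT
    obtain ⟨k, hk, hne⟩ := exists_ne_of_shatters_insert hT hDT hv
    by_cases hki : k = i
    · rwa [← hki]
    · exact absurd (flipAt_of_ne v hki) hne
  by_cases hcol : ∀ x ∈ D, ∀ i, flipAt x i ∈ C → flipAt x i ∉ D → Shatters D {i}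
  · obtain ⟨x, hx, i, hvC, hvD⟩ := hC.exists_boundary_edge hDC hne
    obtain ⟨z, hz⟩ := extremal_iff.1 hD _ (hcol x hx i hvC hvD)
    have hz' : CubeAt D {i} (Function.update z i (x i)) := fun v hv => hz v fun k hk => by
      rw [hv k hk, Function.update_of_ne (by simpa using hk)]
    obtain ⟨w, i, j, hij, hwC, hwD, hi, hj, hji⟩ := hC.exists_square_of_boundary_edge hD hDC.1 hVC
      hcol hx hvC hvD hz' (by simp)
    have hcard : ({i, j} : Finset (Fin n)).card = 2 := Finset.card_pair hij
    have hsub : insert w D ⊆ C := Set.insert_subset hwC hDC.1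
    have hcube : CubeAt (insert w D) {i, j} w := by
      rw [cubeAt_pair_iff, cubeAt_singleton_iff, cubeAt_singleton_iff, flipAt_comm w j i]
      exact ⟨⟨Or.inl rfl, Or.inr hi⟩, Or.inr hj, Or.inr hji⟩
    refine ⟨w, hwC, hwD, key w {i, j} hcube fun T hT hDT => ?_, {i, j}, hcube.shatters,
      fun h => ?_⟩
    · refine (Finset.eq_of_subset_of_card_le ?_ ?_).symm
      · simpa [Finset.insert_subset_iff] using
          ⟨mem_of_flip w i T hi hT hDT, mem_of_flip w j T hj hT hDT⟩
      · rw [hcard]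
        exact hVC T (hT.mono hsub)
    · exact hwD (hD.cubeAt_of_shatters hDC.1 (by simpa [hcard] using hVC) h
        (fun v hv => hsub (hcube v hv)) w fun _ _ => rfl)
  · push Not at hcol
    obtain ⟨x, hx, i, hvC, hvD, hi⟩ := hcol
    have hconst : ∀ y ∈ D, y i = x i := by
      intro y hy
      by_contra hyi
      refine hi (shatters_iff.2 fun b => ?_)
      by_cases hb : x i = b i
      · exact ⟨x, hx, by simpa using hb⟩
      · exact ⟨y, hy, by simpa using Bool.eq_of_ne_of_ne (Ne.symm hyi) hb⟩
    have hcube : CubeAt (insert (flipAt x i) D) {i} (flipAt x i) := by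
      rw [cubeAt_singleton_iff, flipAt_flipAt]
      exact ⟨Or.inl rfl, Or.inr hx⟩
    refine ⟨flipAt x i, hvC, hvD, key _ {i} hcube fun T hT hDT => ?_, {i}, hcube.shatters, hi⟩
    have hiT : i ∈ T := mem_of_flip _ i T (by simpa using hx) hT hDT
    refine Finset.eq_singleton_iff_unique_mem.2 ⟨hiT, fun j hjT => ?_⟩
    by_contra hji
    obtain ⟨u, rfl | hu, hub⟩ := shatters_iff.1 hT (flipAt (flipAt x i) j)
    · simpa using hub j hjT
    · have h1 := hub i hiT
      rw [flipAt_of_ne _ (Ne.symm hji), hconst u hu] at h1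
      simp at h1

theorem extremal_singleton (a : Fin n → Bool) : Extremal {a} := by
  refine extremal_iff.2 fun I hI => ⟨a, fun v hv => ?_⟩
  refine funext fun i => hv i fun hi => ?_
  obtain ⟨u, rfl, hu⟩ := shatters_iff.1 hI fun k => !a k
  simpa using hu i hi

/-- A compression scheme all of whose values are shattered sets. -/
def HasShatteredCompression (D : Set (Fin n → Bool)) : Prop :=
  ∃ r : (Fin n → Bool) → Finset (Fin n), Set.InjOn r D ∧ (∀ v ∈ D, Shatters D (r v)) ∧
    ∀ v ∈ D, ∀ w ∈ D, v ≠ w → ∃ i ∈ r v ∪ r w, v i ≠ w i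

theorem hasShatteredCompression_singleton (a : Fin n → Bool) :
    HasShatteredCompression {a} := by
  refine ⟨fun _ => ∅, Set.injOn_singleton _ _, fun v hv => shatters_iff.2 fun b => ?_, ?_⟩
  · exact ⟨v, hv, by simp⟩
  · rintro v rfl w rfl h
    exact absurd rfl h

theorem HasShatteredCompression.insert {D : Set (Fin n → Bool)} {v : Fin n → Bool}
    {S : Finset (Fin n)} (h : HasShatteredCompression D) (hv : v ∉ D)
    (hS : Shatters (insert v D) S) (hS' : ¬ Shatters D S) :
    HasShatteredCompression (insert v D) := by
  obtain ⟨r, hinj, hr, hsep⟩ := h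
  have hne : ∀ u ∈ D, u ≠ v := fun u hu huv => hv (huv ▸ hu)
  have hru : ∀ u ∈ D, Function.update r v S u = r u := fun u hu =>
    Function.update_of_ne (hne u hu) _ _
  have hrv : Function.update r v S v = S := Function.update_self _ _ _
  refine ⟨Function.update r v S, ?_, ?_, ?_⟩
  · rw [Set.injOn_insert hv]
    refine ⟨fun u hu w hw huw => hinj hu hw (by rwa [hru u hu, hru w hw] at huw), ?_⟩
    rintro ⟨u, hu, huv⟩
    rw [hru u hu, hrv] at huv
    exact hS' (huv ▸ hr u hu)
  · rintro u (rfl | hu)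
    · rwa [hrv]
    · rw [hru u hu]
      exact (hr u hu).mono (Set.subset_insert _ _)
  · rintro u (rfl | hu) w (rfl | hw) huw
    · exact absurd rfl huw
    · obtain ⟨i, hi, hne⟩ := exists_ne_of_shatters_insert hS hS' hw
      exact ⟨i, by simp [hi], hne.symm⟩
    · obtain ⟨i, hi, hne⟩ := exists_ne_of_shatters_insert hS hS' hu
      exact ⟨i, by simp [hi], hne⟩
    · rw [hru u hu, hru w hw]
      exact hsep u hu w hw huw

theorem Extremal.hasShatteredCompression {C : Set (Fin n → Bool)} (hC : Extremal C)
    (hne : C.Nonempty) (hVC : ∀ I, Shatters C I → I.card ≤ 2) : HasShatteredCompression C := by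
  obtain ⟨a, ha⟩ := hne
  obtain ⟨D, ⟨hDC, hDne, hD, hr⟩, hmax⟩ :=
    (Set.toFinite {D | D ⊆ C ∧ D.Nonempty ∧ Extremal D ∧ HasShatteredCompression D}).exists_maximal
      ⟨{a}, by simpa using ha, Set.singleton_nonempty a, extremal_singleton a,
        hasShatteredCompression_singleton a⟩
  rcases hDC.eq_or_ssubset with rfl | hlt
  · exact hr
  · obtain ⟨v, hvC, hvD, hext, S, hS, hS'⟩ := hC.exists_extremal_insert hD hlt hDne hVC
    exact absurd (hmax ⟨Set.insert_subset hvC hDC, Set.insert_nonempty _ _, hext,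
      hr.insert hvD hS hS'⟩ (Set.subset_insert v D) (Set.mem_insert v D)) hvD

/-- Every extremal class of VC dimension `2` admits an unlabelled
compression scheme of size `2`. -/
theorem vc2_extremal_compression (C : Set (Fin n → Bool))
    (hC : Extremal C) (hVC : VCdim C = 2) :
    HasCompression C 2 := by
  rcases C.eq_empty_or_nonempty with rfl | hne
  · exact ⟨fun _ => ∅, by simp, by simp, by simp⟩
  · have hcard : ∀ I, Shatters C I → I.card ≤ 2 := fun I hI => hVC ▸ hI.card_le_VCdim
    obtain ⟨r, hinj, hr, hsep⟩ := hC.hasShatteredCompression hne hcard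
    exact ⟨r, hinj, fun v hv => hcard _ (hr v hv), hsep⟩
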